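/- For every K ∈ ℕ there exists N(K) ∈ ℕ such that for every field F and every finite K-approximate subfield X of F, either |X| < N(K) or 4X + X·4X is a subfield of F. -/

import Mathlib

open Pointwise

universe u

/-- A subset of a ring is additively symmetric if it contains `0` and equals its negation. -/
def AddSymm {R : Type u} [NonUnitalRing R] (X : Set R) : Prop :=
  (0 : R) ∈ X ∧ X = -X

/-- `X` is a `K`-approximate subfield of `F`: it is additively and multiplicatively symmetric
and there is `E ⊆ F` with `|E| ≤ K` such that `X·X + X ⊆ (E·X) ∩ (E + X)`. -/
def IsApproxSubfieldWith {F : Type u} [Field F] (K : ℕ) (X : Set F) : Prop :=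
  AddSymm X ∧ (1 : F) ∈ X ∧ X \ {0} = (X \ {0})⁻¹ ∧
    ∃ E : Finset F, E.card ≤ K ∧ X * X + X ⊆ ((E : Set F) * X) ∩ ((E : Set F) + X)

section helpers
open Finset

/-- Cauchy–Schwarz: few values force many collisions. -/
theorem cs_collision {α β : Type*} [DecidableEq α] [DecidableEq β] (S : Finset α) (f : α → β) :
    S.card ^ 2 ≤ (S.image f).card * ((S ×ˢ S).filter (fun p => f p.1 = f p.2)).card := by
  have h1 : S.card = ∑ y ∈ S.image f, (S.filter (fun s => f s = y)).card :=
    Finset.card_eq_sum_card_image f S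
  have h2 : ((S ×ˢ S).filter (fun p => f p.1 = f p.2)).card
      = ∑ y ∈ S.image f, (S.filter (fun s => f s = y)).card ^ 2 := by
    rw [Finset.card_eq_sum_card_fiberwise (f := fun p => f p.1) (t := S.image f)]
    · apply Finset.sum_congr rfl
      intro y _
      rw [sq, ← Finset.card_product]
      congr 1
      ext ⟨a, b⟩
      simp only [Finset.mem_filter, Finset.mem_product]
      grind
    · intro p hp
      simp only [Finset.coe_filter, Set.mem_ofPred_eq, Finset.mem_product] at hp
      exact Finset.mem_coe.2 (Finset.mem_image_of_mem f hp.1.1)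
  rw [h2, h1]
  exact sq_sum_le_card_mul_sum_sq

variable {F : Type u} [Field F] [DecidableEq F]

/-- `A` is covered by at most `C` translates of `X`. -/
def Cov (X : Finset F) (C : ℕ) (A : Set F) : Prop :=
  ∃ T : Finset F, T.card ≤ C ∧ A ⊆ (T : Set F) + (X : Set F)

theorem Cov.add {X E : Finset F} {K : ℕ} (hK : E.card ≤ K)
    (hE : ∀ x ∈ X, ∀ y ∈ X, ∃ e ∈ E, ∃ z ∈ X, e + z = x + y) {C D : ℕ} {A B : Set F}
    (hA : Cov X C A) (hB : Cov X D B) : Cov X (C * D * K) (A + B) := by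
  obtain ⟨T, hT, hA⟩ := hA
  obtain ⟨U, hU, hB⟩ := hB
  refine ⟨T + U + E, ?_, ?_⟩
  · refine Finset.card_add_le.trans ?_
    exact Nat.mul_le_mul (Finset.card_add_le.trans (Nat.mul_le_mul hT hU)) hK
  · rintro _ ⟨a, ha, b, hb, rfl⟩
    obtain ⟨t, ht, x, hx, rfl⟩ := hA ha
    obtain ⟨s, hs, y, hy, rfl⟩ := hB hb
    obtain ⟨e, he, z, hz, h⟩ := hE x hx y hy
    refine ⟨t + s + e, ?_, z, hz, ?_⟩
    · exact Finset.mem_coe.2 (Finset.add_mem_add (Finset.add_mem_add ht hs) he)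
    · simp only
      linear_combination h

theorem Cov.smul {X E : Finset F} {K : ℕ} (hK : E.card ≤ K)
    (hE : ∀ x ∈ X, ∀ y ∈ X, ∃ e ∈ E, ∃ z ∈ X, e + z = x * y) {C : ℕ} {A : Set F}
    (hA : Cov X C A) {x : F} (hx : x ∈ X) : Cov X (C * K) ((fun t => x * t) '' A) := by
  obtain ⟨T, hT, hA⟩ := hA
  refine ⟨T.image (fun t => x * t) + E, ?_, ?_⟩
  · refine Finset.card_add_le.trans ?_
    exact Nat.mul_le_mul (Finset.card_image_le.trans hT) hK
  · rintro _ ⟨a, ha, rfl⟩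
    obtain ⟨t, ht, y, hy, rfl⟩ := hA ha
    obtain ⟨e, he, z, hz, h⟩ := hE x hx y hy
    refine ⟨x * t + e, ?_, z, hz, ?_⟩
    · exact Finset.mem_coe.2 (Finset.add_mem_add (Finset.mem_image_of_mem _ ht) he)
    · simp only
      linear_combination h

theorem Cov.mono {X : Finset F} {C : ℕ} {A B : Set F} (hA : Cov X C A) (h : B ⊆ A) :
    Cov X C B := by
  obtain ⟨T, hT, hA⟩ := hA
  exact ⟨T, hT, h.trans hA⟩

theorem Cov.pair {X E : Finset F} {K : ℕ} (hK : E.card ≤ K)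
    (hE1 : ∀ x ∈ X, ∀ y ∈ X, ∃ e ∈ E, ∃ z ∈ X, e + z = x + y)
    (hE2 : ∀ x ∈ X, ∀ y ∈ X, ∃ e ∈ E, ∃ z ∈ X, e + z = x * y) {C : ℕ} {A : Set F}
    (hA : Cov X C A) {a : F} (ha : a ∈ X + X) :
    Cov X ((C * K) * (C * K) * K) ((fun t => a * t) '' A) := by
  obtain ⟨x, hx, y, hy, rfl⟩ := Finset.mem_add.1 ha
  refine (Cov.add hK hE1 (hA.smul hK hE2 hx) (hA.smul hK hE2 hy)).mono ?_
  rintro _ ⟨t, ht, rfl⟩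
  exact ⟨x * t, ⟨t, ht, rfl⟩, y * t, ⟨t, ht, rfl⟩, by simp only; ring⟩

theorem quot_of_cov {X : Finset F} (hneg : ∀ x ∈ X, -x ∈ X) {C : ℕ} (hC : C < X.card) {u v : F}
    (hu : u ≠ 0)
    (hA : Cov X C ((fun t => u * t) '' (X : Set F) + (fun t => v * t) '' (X : Set F))) :
    v / u ∈ (X + X) / (X + X) := by
  obtain ⟨T, hT, hA⟩ := hA
  have hcard : (T + X).card < (X ×ˢ X).card := by
    refine lt_of_le_of_lt Finset.card_add_le ?_
    rw [Finset.card_product]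
    exact Nat.mul_lt_mul_of_pos_right (lt_of_le_of_lt hT hC) (by omega)
  obtain ⟨p, hp, r, hr, hne, heq⟩ := Finset.exists_ne_map_eq_of_card_lt_of_maps_to hcard
    (f := fun p : F × F => u * p.1 + v * p.2) (by
      intro p hp
      have hp := Finset.mem_product.1 (Finset.mem_coe.1 hp)
      have := hA (Set.add_mem_add (Set.mem_image_of_mem _ (Finset.mem_coe.2 hp.1))
        (Set.mem_image_of_mem _ (Finset.mem_coe.2 hp.2)))
      rw [← Finset.coe_add] at this
      exact this)
  rw [Finset.mem_product] at hp hr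
  have h2 : p.2 - r.2 ≠ 0 := by
    intro h
    have hfy : p.2 = r.2 := sub_eq_zero.1 h
    rw [hfy] at heq
    have : p.1 = r.1 := mul_left_cancel₀ hu (add_right_cancel heq)
    exact hne (Prod.ext this hfy)
  refine Finset.mem_div.2 ⟨r.1 + -p.1, Finset.add_mem_add hr.1 (hneg _ hp.1),
    p.2 + -r.2, Finset.add_mem_add hp.2 (hneg _ hr.2), ?_⟩
  have h3 : p.2 + -r.2 ≠ 0 := by rwa [← sub_eq_add_neg]
  rw [div_eq_div_iff h3 hu]
  linear_combination -heq

theorem energy_sum (X L : Finset F) :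
    ∑ t ∈ L, (((X ×ˢ X) ×ˢ (X ×ˢ X)).filter
      (fun p => p.1.1 + t * p.1.2 = p.2.1 + t * p.2.2)).card
      ≤ X.card ^ 4 + L.card * X.card ^ 2 := by
  simp_rw [Finset.card_filter]
  rw [Finset.sum_comm]
  have key : ∀ p ∈ ((X ×ˢ X) ×ˢ (X ×ˢ X)),
      (∑ t ∈ L, if p.1.1 + t * p.1.2 = p.2.1 + t * p.2.2 then 1 else 0)
        ≤ 1 + (if p.1 = p.2 then L.card else 0) := by
    intro p _
    rw [← Finset.card_filter]
    by_cases h : p.1 = p.2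
    · rw [if_pos h]
      exact (Finset.card_filter_le _ _).trans (by omega)
    · rw [if_neg h, add_zero, Finset.card_le_one]
      intro s hs t ht
      have hs := (Finset.mem_filter.1 hs).2
      have ht := (Finset.mem_filter.1 ht).2
      by_contra hst
      have h1 : (s - t) * (p.1.2 - p.2.2) = 0 := by linear_combination hs - ht
      have h2 : p.1.2 = p.2.2 :=
        sub_eq_zero.1 ((mul_eq_zero.1 h1).resolve_left (sub_ne_zero.2 hst))
      rw [h2] at hs
      exact h (Prod.ext (add_right_cancel hs) h2)
  refine (Finset.sum_le_sum key).trans ?_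
  rw [Finset.sum_add_distrib]
  apply add_le_add
  · simp only [Finset.sum_const, Finset.card_product, smul_eq_mul, mul_one]
    apply le_of_eq; ring
  · rw [Finset.sum_product]
    simp only [Finset.sum_ite_eq]
    rw [Finset.sum_congr rfl (fun x hx => if_pos hx)]
    simp only [Finset.sum_const, Finset.card_product, smul_eq_mul]
    apply le_of_eq; ring

theorem dense_case (X L : Finset F) (hXL : X ⊆ L) (hadd : ∀ x ∈ L, ∀ y ∈ L, x + y ∈ L)
    (hneg : ∀ x ∈ L, -x ∈ L)
    (hmul : ∀ x ∈ L, ∀ y ∈ L, x * y ∈ L) (hcard : L.card ^ 2 < X.card ^ 3) :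
    ∃ t ∈ X, ∀ z ∈ L, ∃ a ∈ X, ∃ b ∈ X, ∃ c ∈ X, ∃ d ∈ X, z = (a + t * b) + (c + t * d) := by
  set Y : F → Finset F := fun t => (X ×ˢ X).image (fun p => p.1 + t * p.2) with hY
  set En : F → ℕ := fun t => (((X ×ˢ X) ×ˢ (X ×ˢ X)).filter
      (fun p => p.1.1 + t * p.1.2 = p.2.1 + t * p.2.2)).card with hEn
  have hcs : ∀ t, X.card ^ 4 ≤ (Y t).card * En t := by
    intro t
    have := cs_collision (X ×ˢ X) (fun p => p.1 + t * p.2)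
    rw [Finset.card_product] at this
    calc X.card ^ 4 = (X.card * X.card) ^ 2 := by ring
      _ ≤ _ := this
  have hYL : ∀ t ∈ L, Y t ⊆ L := by
    intro t ht z hz
    obtain ⟨p, hp, rfl⟩ := Finset.mem_image.1 hz
    rw [Finset.mem_product] at hp
    exact hadd _ (hXL hp.1) _ (hmul _ ht _ (hXL hp.2))
  have hex : ∃ t ∈ X, L.card < 2 * (Y t).card := by
    by_contra! hno
    have hsum : ∑ t ∈ L, En t ≤ X.card ^ 4 + L.card * X.card ^ 2 := energy_sum X L
    have hlow : ∀ t ∈ L, X.card ^ 4 + (if t ∈ X then X.card ^ 4 else 0) ≤ L.card * En t := by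
      intro t ht
      split_ifs with h
      · calc X.card ^ 4 + X.card ^ 4 ≤ 2 * ((Y t).card * En t) := by linarith [hcs t]
          _ = (2 * (Y t).card) * En t := by ring
          _ ≤ _ := Nat.mul_le_mul_right _ (hno t h)
      · exact (hcs t).trans (Nat.mul_le_mul_right _ (Finset.card_le_card (hYL t ht)))
    have h1 := Finset.sum_le_sum hlow
    rw [Finset.sum_add_distrib, ← Finset.mul_sum, ← Finset.sum_filter,
      Finset.filter_mem_eq_inter, Finset.inter_eq_right.2 hXL] at h1
    simp only [Finset.sum_const, smul_eq_mul] at h1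
    have h2 := h1.trans (Nat.mul_le_mul_left L.card hsum)
    have hpos : 0 < X.card ^ 2 := by
      rcases Nat.eq_zero_or_pos X.card with h | h
      · rw [h] at hcard; simp at hcard
      · positivity
    nlinarith [Nat.mul_lt_mul_of_pos_right hcard hpos]
  obtain ⟨t, ht, hlt⟩ := hex
  refine ⟨t, ht, fun z hz => ?_⟩
  have hZ : (Y t).image (fun y => z - y) ⊆ L := by
    intro w hw
    obtain ⟨y, hy, rfl⟩ := Finset.mem_image.1 hw
    rw [sub_eq_add_neg]
    exact hadd _ hz _ (hneg _ (hYL t (hXL ht) hy))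
  have hZc : ((Y t).image (fun y => z - y)).card = (Y t).card :=
    Finset.card_image_of_injective _ sub_right_injective
  obtain ⟨w, hw⟩ : (Y t ∩ (Y t).image (fun y => z - y)).Nonempty := by
    rw [← Finset.card_pos]
    have h1 := Finset.card_union_add_card_inter (Y t) ((Y t).image (fun y => z - y))
    have h2 := Finset.card_le_card (Finset.union_subset (hYL t (hXL ht)) hZ)
    omega
  rw [Finset.mem_inter] at hw
  obtain ⟨p, hp, hpw⟩ := Finset.mem_image.1 hw.1
  obtain ⟨y, hy, hyw⟩ := Finset.mem_image.1 hw.2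
  obtain ⟨r, hr, hry⟩ := Finset.mem_image.1 hy
  rw [Finset.mem_product] at hp hr
  refine ⟨p.1, hp.1, p.2, hp.2, r.1, hr.1, r.2, hr.2, ?_⟩
  rw [hpw, hry, ← hyw]; ring

end helpers

/-- Classification of finite approximate subfields: for every `K` there is `N(K)` such that
every finite `K`-approximate subfield `X` either has `|X| < N(K)` or `4X + X·4X` is a
subfield. -/
theorem stmt11 (K : ℕ) :
    ∃ N : ℕ, ∀ (F : Type u) [Field F] (X : Set F),
      X.Finite → IsApproxSubfieldWith K X →
      X.ncard < N ∨
        ∃ L : Subfield F, (L : Set F) = (X + X + X + X) + X * (X + X + X + X) := by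
  classical
  refine ⟨K ^ 29 + 1, ?_⟩
  intro F _ X hfin hX
  lift X to Finset F using hfin
  rw [or_iff_not_imp_left, Set.ncard_coe_finset]
  intro hN
  have hN : K ^ 29 < X.card := by omega
  obtain ⟨⟨h0, hs⟩, h1, hinv, E, hK, hE⟩ := hX
  rw [Finset.mem_coe] at h0 h1
  have hneg : ∀ x ∈ X, -x ∈ X := by
    intro x hx
    have : x ∈ (X : Set F) := hx
    rw [hs] at this
    exact this
  have hinvX : ∀ x ∈ X, x⁻¹ ∈ X := by
    intro x hx
    by_cases hx0 : x = 0
    · rw [hx0, inv_zero]; exact h0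
    · have : x ∈ (X : Set F) \ {0} := ⟨hx, hx0⟩
      rw [hinv] at this
      exact this.1
  have hadd : ∀ x ∈ X, ∀ y ∈ X, x + y ∈ (X : Set F) * X + X := fun x hx y hy =>
    ⟨x, ⟨x, hx, 1, h1, mul_one x⟩, y, hy, rfl⟩
  have hmul : ∀ x ∈ X, ∀ y ∈ X, x * y ∈ (X : Set F) * X + X := fun x hx y hy =>
    ⟨x * y, ⟨x, hx, y, hy, rfl⟩, 0, h0, add_zero _⟩
  have hE1 : ∀ x ∈ X, ∀ y ∈ X, ∃ e ∈ E, ∃ z ∈ X, e + z = x + y := fun x hx y hy =>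
    (hE (hadd x hx y hy)).2
  have hE2 : ∀ x ∈ X, ∀ y ∈ X, ∃ e ∈ E, ∃ z ∈ X, e + z = x * y := fun x hx y hy =>
    (hE (hmul x hx y hy)).2
  have hM1 : ∀ x ∈ X, ∀ y ∈ X, ∃ e ∈ E, ∃ z ∈ X, e * z = x + y := fun x hx y hy =>
    (hE (hadd x hx y hy)).1
  have hM2 : ∀ x ∈ X, ∀ y ∈ X, ∃ e ∈ E, ∃ z ∈ X, e * z = x * y := fun x hx y hy =>
    (hE (hmul x hx y hy)).1
  have hKpos : 1 ≤ K := by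
    obtain ⟨e, he, _⟩ := hE1 0 h0 0 h0
    exact (Finset.card_pos.2 ⟨e, he⟩).trans_le hK
  set L : Finset F := (X + X) / (X + X) with hL
  have hXX : ∀ x ∈ X, x ∈ X + X := fun x hx => by
    simpa using Finset.add_mem_add hx h0
  have hXL : X ⊆ L := fun x hx => Finset.mem_div.2 ⟨x, hXX x hx, 1, hXX 1 h1, div_one x⟩
  -- every element of `L` has a representation with nonzero denominator
  have hrep : ∀ z ∈ L, ∃ a ∈ X + X, ∃ b ∈ X + X, b ≠ 0 ∧ z = a / b := by
    intro z hz
    obtain ⟨a, ha, b, hb, rfl⟩ := Finset.mem_div.1 hz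
    by_cases hb0 : b = 0
    · exact ⟨0, hXX 0 h0, 1, hXX 1 h1, one_ne_zero, by simp [hb0]⟩
    · exact ⟨a, ha, b, hb, hb0, rfl⟩
  have hc1 : Cov X 1 (X : Set F) := ⟨{0}, by simp, by simp⟩
  have hc2 : ∀ a ∈ X + X, ∀ b ∈ X + X, Cov X (K ^ 9) ((fun t => a * b * t) '' (X : Set F)) := by
    intro a ha b hb
    have := (hc1.pair hK hE1 hE2 hb).pair hK hE1 hE2 ha
    rw [Set.image_image] at this
    convert this using 1
    · ring
    · congr 1; ext t; ring
  have hLmul : ∀ x ∈ L, ∀ y ∈ L, x * y ∈ L := by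
    intro x hx y hy
    obtain ⟨a, ha, b, hb, hb0, rfl⟩ := hrep x hx
    obtain ⟨c, hc, d, hd, hd0, rfl⟩ := hrep y hy
    rw [div_mul_div_comm]
    refine quot_of_cov hneg (C := K ^ 9 * K ^ 9 * K) ?_ (mul_ne_zero hb0 hd0)
      (Cov.add hK hE1 (hc2 b hb d hd) (hc2 a ha c hc))
    refine lt_of_le_of_lt ?_ hN
    calc K ^ 9 * K ^ 9 * K = K ^ 19 := by ring
      _ ≤ K ^ 29 := Nat.pow_le_pow_right hKpos (by norm_num)
  have hLadd : ∀ x ∈ L, ∀ y ∈ L, x + y ∈ L := by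
    intro x hx y hy
    obtain ⟨a, ha, b, hb, hb0, rfl⟩ := hrep x hx
    obtain ⟨c, hc, d, hd, hd0, rfl⟩ := hrep y hy
    rw [div_add_div _ _ hb0 hd0]
    refine quot_of_cov hneg (C := K ^ 9 * (K ^ 9 * K ^ 9 * K) * K) ?_ (mul_ne_zero hb0 hd0)
      (Cov.add hK hE1 (hc2 b hb d hd)
        ((Cov.add hK hE1 (hc2 a ha d hd) (hc2 b hb c hc)).mono ?_))
    · refine lt_of_le_of_lt (le_of_eq ?_) hN
      ring
    · rintro _ ⟨t, ht, rfl⟩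
      exact ⟨_, ⟨t, ht, rfl⟩, _, ⟨t, ht, rfl⟩, by simp only; ring⟩
  have hLneg : ∀ x ∈ L, -x ∈ L := by
    intro x hx
    have := hLmul _ (hXL (hneg 1 h1)) x hx
    simpa using this
  have hLinv : ∀ x ∈ L, x⁻¹ ∈ L := by
    intro x hx
    obtain ⟨a, ha, b, hb, rfl⟩ := Finset.mem_div.1 hx
    exact Finset.mem_div.2 ⟨b, hb, a, ha, by rw [inv_div]⟩
  have hLcard : L.card ≤ K ^ 3 * X.card := by
    have hsub : L ⊆ (E / E * E) * X := by
      intro z hz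
      obtain ⟨a, ha, b, hb, rfl⟩ := Finset.mem_div.1 hz
      obtain ⟨a1, ha1, a2, ha2, rfl⟩ := Finset.mem_add.1 ha
      obtain ⟨b1, hb1, b2, hb2, rfl⟩ := Finset.mem_add.1 hb
      obtain ⟨e, he, x, hx, h⟩ := hM1 a1 ha1 a2 ha2
      obtain ⟨f, hf, y, hy, hfy⟩ := hM1 b1 hb1 b2 hb2
      obtain ⟨g, hg, w, hw, hgw⟩ := hM2 x hx y⁻¹ (hinvX y hy)
      refine Finset.mem_mul.2 ⟨e / f * g, Finset.mul_mem_mul (Finset.div_mem_div he hf) hg,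
        w, hw, ?_⟩
      rw [← h, ← hfy, mul_assoc, hgw, mul_div_mul_comm, div_eq_mul_inv x y]
    calc L.card ≤ ((E / E * E) * X).card := Finset.card_le_card hsub
      _ ≤ (E / E * E).card * X.card := Finset.card_mul_le
      _ ≤ ((E / E).card * E.card) * X.card := Nat.mul_le_mul_right _ Finset.card_mul_le
      _ ≤ ((E.card * E.card) * E.card) * X.card :=
        Nat.mul_le_mul_right _ (Nat.mul_le_mul_right _ Finset.card_div_le)
      _ ≤ ((K * K) * K) * X.card := by gcongr
      _ = K ^ 3 * X.card := by ring
  have hcard : L.card ^ 2 < X.card ^ 3 := by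
    have h6 : K ^ 6 < X.card :=
      lt_of_le_of_lt (Nat.pow_le_pow_right hKpos (by norm_num)) hN
    have hpos : 0 < X.card := by omega
    calc L.card ^ 2 ≤ (K ^ 3 * X.card) ^ 2 := Nat.pow_le_pow_left hLcard 2
      _ = K ^ 6 * X.card ^ 2 := by ring
      _ < X.card * X.card ^ 2 := Nat.mul_lt_mul_of_pos_right h6 (Nat.pow_pos hpos)
      _ = X.card ^ 3 := by ring
  obtain ⟨t, ht, hfull⟩ := dense_case X L hXL hLadd hLneg hLmul hcard
  refine ⟨{ carrier := (L : Set F)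
            mul_mem' := fun {a b} ha hb => hLmul a ha b hb
            one_mem' := hXL h1
            add_mem' := fun {a b} ha hb => hLadd a ha b hb
            zero_mem' := hXL h0
            neg_mem' := fun {a} ha => hLneg a ha
            inv_mem' := fun a ha => hLinv a ha }, ?_⟩
  change (L : Set F) = _
  apply Set.Subset.antisymm
  · intro z hz
    obtain ⟨a, ha, b, hb, c, hc, d, hd, rfl⟩ := hfull z hz
    have h4 : ∀ x ∈ X, ∀ y ∈ X, x + y ∈ (X : Set F) + X + X + X := fun x hx y hy =>
      ⟨x + y + 0, ⟨x + y, ⟨x, hx, y, hy, rfl⟩, 0, h0, rfl⟩, 0, h0, (add_zero _).trans (add_zero _)⟩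
    exact ⟨a + c, h4 a ha c hc, t * (b + d), ⟨t, ht, b + d, h4 b hb d hd, rfl⟩,
      by simp only; ring⟩
  · have h4 : ∀ z ∈ (X : Set F) + X + X + X, z ∈ L := by
      rintro _ ⟨_, ⟨_, ⟨a, ha, b, hb, rfl⟩, c, hc, rfl⟩, d, hd, rfl⟩
      exact hLadd _ (hLadd _ (hLadd _ (hXL ha) _ (hXL hb)) _ (hXL hc)) _ (hXL hd)
    rintro _ ⟨a, ha, _, ⟨x, hx, b, hb, rfl⟩, rfl⟩
    exact hLadd _ (h4 a ha) _ (hLmul _ (hXL hx) _ (h4 b hb))
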